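/- Let I be an Artinian monomial ideal in S = k[x_1,...,x_n] with maximal ideal m. Then reg(S/I) = max{ deg f : f a monomial in (I : m) \ I }. -/

import Mathlib

open MvPolynomial

/-- A minimal graded free resolution of `S/I`: `F i = ⊕_a S(−deg i a)`, with graded
differentials given by matrices whose entries lie in the maximal ideal (minimality),
exact, of finite length, and resolving `S/I` (the image of `F 1 → F 0 = S` is `I`).
The graded Betti number `β_{i,j}(S/I)` is the number of indices `a` with
`deg i a = j`. -/
structure MinimalGradedFreeResolution {k : Type*} [Field k] (n : ℕ)
    (I : Ideal (MvPolynomial (Fin n) k)) where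
  len : ℕ
  rank : ℕ → ℕ
  deg : (i : ℕ) → Fin (rank i) → ℕ
  rank_zero : rank 0 = 1
  deg_zero : ∀ a, deg 0 a = 0
  mat : (i : ℕ) → Matrix (Fin (rank i)) (Fin (rank (i + 1))) (MvPolynomial (Fin n) k)
  homog : ∀ i a b, (mat i a b).IsHomogeneous (deg (i + 1) b - deg i a)
  minimal : ∀ i a b, constantCoeff (mat i a b) = 0
  finiteLength : ∀ i, len < i → rank i = 0
  exactness : ∀ i, LinearMap.ker (mat i).mulVecLin = LinearMap.range (mat (i + 1)).mulVecLin
  resolves : ∀ a : Fin (rank 0), Ideal.span (Set.range fun b => mat 0 a b) = I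

/-- The Castelnuovo–Mumford regularity computed from a minimal graded free resolution:
`reg = max { j − i : β_{i,j} ≠ 0 }`. -/
noncomputable def MinimalGradedFreeResolution.reg {k : Type*} [Field k] {n : ℕ}
    {I : Ideal (MvPolynomial (Fin n) k)} (F : MinimalGradedFreeResolution n I) : ℤ :=
  sSup { z : ℤ | ∃ (i : ℕ) (a : Fin (F.rank i)), z = (F.deg i a : ℤ) - (i : ℤ) }

namespace MvPolynomial

variable {σ k : Type*} [Field k]

/-- The part of `p` consisting of the terms whose exponent satisfies `Q`. -/
noncomputable def termsWith (Q : (σ →₀ ℕ) → Prop) (p : MvPolynomial σ k) : MvPolynomial σ k :=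
  open Classical in ∑ m ∈ p.support with Q m, monomial m (coeff m p)

open Classical in
lemma coeff_termsWith (Q : (σ →₀ ℕ) → Prop) (p : MvPolynomial σ k) (m : σ →₀ ℕ) :
    coeff m (termsWith Q p) = if Q m then coeff m p else 0 := by
  simp only [termsWith, coeff_sum, coeff_monomial, Finset.sum_ite_eq', Finset.mem_filter,
    mem_support_iff]
  split_ifs <;> simp_all

lemma of_mem_support_termsWith {Q : (σ →₀ ℕ) → Prop} {p : MvPolynomial σ k} {m : σ →₀ ℕ}
    (hm : m ∈ (termsWith Q p).support) : Q m := by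
  classical
  rw [mem_support_iff, coeff_termsWith] at hm
  by_contra h
  simp [h] at hm

lemma termsWith_add_termsWith_not (Q : (σ →₀ ℕ) → Prop) (p : MvPolynomial σ k) :
    termsWith Q p + termsWith (fun m => ¬ Q m) p = p := by
  classical
  ext m
  rw [coeff_add, coeff_termsWith, coeff_termsWith]
  by_cases h : Q m <;> simp [h]

/-- The ideal generated by the first `j` variables. -/
noncomputable def initialVars (k : Type*) [Field k] (n j : ℕ) : Ideal (MvPolynomial (Fin n) k) :=
  Ideal.span (X '' {i : Fin n | i.val < j})

variable {n : ℕ}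

lemma mem_initialVars {j : ℕ} {p : MvPolynomial (Fin n) k} :
    p ∈ initialVars k n j ↔ ∀ m ∈ p.support, ∃ i : Fin n, i.val < j ∧ m i ≠ 0 :=
  mem_ideal_span_X_image

lemma mem_initialVars_zero {p : MvPolynomial (Fin n) k} : p ∈ initialVars k n 0 ↔ p = 0 := by
  simp [initialVars]

lemma initialVars_mono {j l : ℕ} (h : j ≤ l) : initialVars k n j ≤ initialVars k n l :=
  Ideal.span_mono (Set.image_mono fun _ hi => lt_of_lt_of_le hi h)

lemma X_mem_initialVars {j : ℕ} (i : Fin n) (hi : i.val < j) :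
    (X i : MvPolynomial (Fin n) k) ∈ initialVars k n j :=
  Ideal.subset_span ⟨i, hi, rfl⟩

/-- A variable is a nonzerodivisor modulo the ideal of the preceding variables. -/
lemma mem_initialVars_of_X_mul_mem (i : Fin n) {p : MvPolynomial (Fin n) k}
    (h : X i * p ∈ initialVars k n i) : p ∈ initialVars k n i := by
  rw [mem_initialVars] at h ⊢
  intro m hm
  obtain ⟨l, hl, hne⟩ := h (Finsupp.single i 1 + m) (by
    rw [mem_support_iff, coeff_X_mul]
    exact mem_support_iff.1 hm)
  refine ⟨l, hl, ?_⟩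
  have hil : i ≠ l := fun h => by simp [h] at hl
  simpa [Finsupp.single_apply, hil] using hne

lemma sub_X_mul_divMonomial_mem_initialVars (i : Fin n) {p : MvPolynomial (Fin n) k}
    (h : p ∈ initialVars k n (i + 1)) :
    p - X i * p.divMonomial (Finsupp.single i 1) ∈ initialVars k n i := by
  have hp : p - X i * p.divMonomial (Finsupp.single i 1) = p.modMonomial (Finsupp.single i 1) := by
    conv_lhs => enter [1]; rw [← divMonomial_add_modMonomial_single p i]
    ring
  rw [hp]
  rw [mem_initialVars] at h ⊢
  intro m hm
  rw [mem_support_iff] at hm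
  have hle : ¬ Finsupp.single i 1 ≤ m := fun hle => hm (coeff_modMonomial_of_le p hle)
  rw [coeff_modMonomial_of_not_le p hle] at hm
  obtain ⟨l, hl, hne⟩ := h m (mem_support_iff.2 hm)
  refine ⟨l, lt_of_le_of_ne (Nat.lt_succ_iff.1 hl) fun hli => hle ?_, hne⟩
  rw [Finsupp.single_le_iff, ← Fin.ext hli]
  exact Nat.one_le_iff_ne_zero.2 hne

end MvPolynomial

namespace MinimalGradedFreeResolution

open Matrix

variable {k : Type*} [Field k] {n : ℕ} {I : Ideal (MvPolynomial (Fin n) k)}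
  (F : MinimalGradedFreeResolution n I)

/-- All terms of `z` live in internal degrees satisfying `P`. -/
def DegreesIn (P : ℕ → Prop) (i : ℕ) (z : Fin (F.rank i) → MvPolynomial (Fin n) k) : Prop :=
  ∀ a, ∀ m ∈ (z a).support, P (m.degree + F.deg i a)

/-- `z` is a cycle in `F` modulo the ideal `J`. -/
def IsCycleMod (J : Ideal (MvPolynomial (Fin n) k)) :
    (i : ℕ) → (Fin (F.rank i) → MvPolynomial (Fin n) k) → Prop
  | 0, _ => True
  | i + 1, z => ∀ a, (F.mat i *ᵥ z) a ∈ J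

lemma mulVec_mem {J : Ideal (MvPolynomial (Fin n) k)} (i : ℕ)
    {z : Fin (F.rank (i + 1)) → MvPolynomial (Fin n) k} (hz : ∀ a, z a ∈ J) (a) :
    (F.mat i *ᵥ z) a ∈ J := by
  rw [mulVec, dotProduct]
  exact Ideal.sum_mem _ fun b _ => Ideal.mul_mem_left _ _ (hz b)

lemma mulVec_mulVec_eq_zero (i : ℕ) (z : Fin (F.rank (i + 2)) → MvPolynomial (Fin n) k) :
    F.mat i *ᵥ (F.mat (i + 1) *ᵥ z) = 0 := by
  have : (F.mat (i + 1)).mulVecLin z ∈ LinearMap.ker (F.mat i).mulVecLin := by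
    rw [F.exactness]
    exact ⟨z, rfl⟩
  simpa using this

variable {F}

lemma DegreesIn.mulVec {P : ℕ → Prop} {i : ℕ}
    {z : Fin (F.rank (i + 1)) → MvPolynomial (Fin n) k} (hz : F.DegreesIn P (i + 1) z) :
    F.DegreesIn P i (F.mat i *ᵥ z) := by
  classical
  intro a m hm
  obtain ⟨b, -, hb⟩ := Finset.mem_biUnion.1 (support_sum hm)
  obtain ⟨m₁, h₁, m₂, h₂, rfl⟩ := Finset.mem_add.1 (support_mul _ _ hb)
  have hdeg : m₁.degree = F.deg (i + 1) b - F.deg i a := by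
    rw [Finsupp.degree_eq_weight_one]
    exact F.homog i a b (mem_support_iff.1 h₁)
  have hpos : m₁.degree ≠ 0 := fun h => by
    rw [Finsupp.degree_eq_zero_iff] at h
    subst h
    exact mem_support_iff.1 h₁ (F.minimal i a b)
  have := hz b m₂ h₂
  rw [map_add]
  convert this using 1
  omega

lemma DegreesIn.sub {P : ℕ → Prop} {i : ℕ} {y z : Fin (F.rank i) → MvPolynomial (Fin n) k}
    (hy : F.DegreesIn P i y) (hz : F.DegreesIn P i z) : F.DegreesIn P i (y - z) := by
  classical
  intro a m hm
  rcases Finset.mem_union.1 (support_sub _ _ _ hm) with h | h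
  exacts [hy a m h, hz a m h]

lemma DegreesIn.X_smul {c i : ℕ} {z : Fin (F.rank i) → MvPolynomial (Fin n) k}
    (hz : F.DegreesIn (c ≤ ·) i z) (l : Fin n) :
    F.DegreesIn (c + 1 ≤ ·) i ((X l : MvPolynomial (Fin n) k) • z) := by
  classical
  intro a m hm
  rw [Pi.smul_apply, smul_eq_mul, support_X_mul, Finset.mem_map] at hm
  obtain ⟨m', hm', rfl⟩ := hm
  have := hz a m' hm'
  simp only [addLeftEmbedding_apply, map_add, Finsupp.degree_single]
  omega

lemma DegreesIn.divMonomial {c i : ℕ} {z : Fin (F.rank i) → MvPolynomial (Fin n) k}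
    (hz : F.DegreesIn (c + 1 ≤ ·) i z) (l : Fin n) :
    F.DegreesIn (c ≤ ·) i fun a => (z a).divMonomial (Finsupp.single l 1) := by
  intro a m hm
  rw [mem_support_iff, coeff_divMonomial] at hm
  have := hz a _ (mem_support_iff.2 hm)
  simp only [map_add, Finsupp.degree_single] at this
  omega

/-- A boundary modulo variables is the image of an element in the same degrees. -/
lemma DegreesIn.exists_lift {P : ℕ → Prop} {i j : ℕ}
    {z : Fin (F.rank i) → MvPolynomial (Fin n) k} (hz : F.DegreesIn P i z)
    {u : Fin (F.rank (i + 1)) → MvPolynomial (Fin n) k}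
    (hu : ∀ a, (z - F.mat i *ᵥ u) a ∈ initialVars k n j) :
    ∃ v, F.DegreesIn P (i + 1) v ∧ ∀ a, (z - F.mat i *ᵥ v) a ∈ initialVars k n j := by
  classical
  let v := fun b => termsWith (fun m => P (m.degree + F.deg (i + 1) b)) (u b)
  let w := fun b => termsWith (fun m => ¬ P (m.degree + F.deg (i + 1) b)) (u b)
  have hv : F.DegreesIn P (i + 1) v := fun b m hm => of_mem_support_termsWith hm
  have hw : F.DegreesIn (fun e => ¬ P e) (i + 1) w := fun b m hm => of_mem_support_termsWith hm
  have hvw : u = v + w := funext fun b => (termsWith_add_termsWith_not _ (u b)).symm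
  refine ⟨v, hv, fun a => mem_initialVars.2 fun m hm => mem_initialVars.1 (hu a) m ?_⟩
  have hP := (hz.sub hv.mulVec) a m hm
  have hm' : coeff m ((F.mat i *ᵥ w) a) = 0 := by
    by_contra h
    exact hw.mulVec a m (mem_support_iff.2 h) hP
  rw [hvw, mulVec_add, ← sub_sub, mem_support_iff, Pi.sub_apply, coeff_sub, hm', sub_zero]
  exact mem_support_iff.1 hm

variable (F)

lemma exists_mulVec_eq_of_mem (z : Fin (F.rank 0) → MvPolynomial (Fin n) k)
    (hz : ∀ a, z a ∈ I) : ∃ u, F.mat 0 *ᵥ u = z := by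
  have hsub : Subsingleton (Fin (F.rank 0)) := by
    rw [F.rank_zero]
    infer_instance
  let a₀ : Fin (F.rank 0) := ⟨0, by rw [F.rank_zero]; exact one_pos⟩
  have h := hz a₀
  rw [← F.resolves a₀, Ideal.mem_span_range_iff_exists_fun] at h
  obtain ⟨c, hc⟩ := h
  refine ⟨c, funext fun a => ?_⟩
  rw [Subsingleton.elim a a₀, ← hc, mulVec, dotProduct]
  exact Finset.sum_congr rfl fun b _ => mul_comm _ _

lemma mulVec_mem_ideal (u) (a) : (F.mat 0 *ᵥ u) a ∈ I := by
  have hmem : ∀ b, F.mat 0 a b ∈ I := fun b =>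
    (F.resolves a).le (Ideal.subset_span ⟨b, rfl⟩)
  rw [mulVec, dotProduct]
  exact Ideal.sum_mem _ fun b _ => Ideal.mul_mem_right _ _ (hmem b)

/-- In high degrees the homology of `F` modulo the first variables vanishes. -/
lemma exists_boundary {d : ℕ}
    (hd : ∀ p : MvPolynomial (Fin n) k, (∀ m ∈ p.support, d < m.degree) → p ∈ I) {j : ℕ}
    (hj : j ≤ n) {i : ℕ} {z : Fin (F.rank i) → MvPolynomial (Fin n) k}
    (hz : F.DegreesIn (d + i + 1 ≤ ·) i z) (hcyc : F.IsCycleMod (initialVars k n j) i z) :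
    ∃ u, F.DegreesIn (d + i + 1 ≤ ·) (i + 1) u ∧
      ∀ a, (z - F.mat i *ᵥ u) a ∈ initialVars k n j := by
  suffices h : ∃ u, ∀ a, (z - F.mat i *ᵥ u) a ∈ initialVars k n j from
    hz.exists_lift h.choose_spec
  cases i with
  | zero =>
    obtain ⟨u, rfl⟩ := F.exists_mulVec_eq_of_mem z fun a => hd _ fun m hm => by
      simpa [F.deg_zero, Nat.succ_le_iff] using hz a m hm
    exact ⟨u, by simp⟩
  | succ i =>
    induction j generalizing i with
    | zero =>
      have : z ∈ LinearMap.ker (F.mat i).mulVecLin := by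
        rw [LinearMap.mem_ker, mulVecLin_apply]
        exact funext fun a => mem_initialVars_zero.1 (hcyc a)
      rw [F.exactness] at this
      obtain ⟨u, rfl⟩ := this
      exact ⟨u, by simp⟩
    | succ j ih =>
      let l : Fin n := ⟨j, hj⟩
      let p := F.mat i *ᵥ z
      let w := fun a => (p a).divMonomial (Finsupp.single l 1)
      have hw : F.DegreesIn (d + i + 1 ≤ ·) i w := DegreesIn.divMonomial hz.mulVec l
      have hr : ∀ a, (p - (X l : MvPolynomial (Fin n) k) • w) a ∈ initialVars k n j :=
        fun a => sub_X_mul_divMonomial_mem_initialVars l (hcyc a)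
      obtain ⟨v, hv, hwv⟩ : ∃ v, F.DegreesIn (d + i + 1 ≤ ·) (i + 1) v ∧
          ∀ a, (w - F.mat i *ᵥ v) a ∈ initialVars k n j := by
        suffices h : ∃ u, ∀ a, (w - F.mat i *ᵥ u) a ∈ initialVars k n j from
          hw.exists_lift h.choose_spec
        cases i with
        | zero =>
          obtain ⟨u, hu⟩ := F.exists_mulVec_eq_of_mem w fun a => hd _ fun m hm => by
            simpa [F.deg_zero, Nat.succ_le_iff] using hw a m hm
          exact ⟨u, by simp [hu]⟩
        | succ i =>
          refine ih (by omega) i hw fun a => mem_initialVars_of_X_mul_mem l ?_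
          have := F.mulVec_mem i hr a
          rw [mulVec_sub, F.mulVec_mulVec_eq_zero, mulVec_smul, zero_sub, Pi.neg_apply,
            neg_mem_iff] at this
          exact this
      obtain ⟨u, hu⟩ := ih (by omega) i (z := z - (X l : MvPolynomial (Fin n) k) • v)
        (hz.sub (hv.X_smul l)) fun a => by
          have := add_mem (hr a) (Ideal.mul_mem_left _ (X l) (hwv a))
          convert this using 1
          simp only [mulVec_sub, mulVec_smul, Pi.sub_apply, Pi.smul_apply, smul_eq_mul, p]
          ring
      refine ⟨u, fun a => ?_⟩
      have := add_mem (initialVars_mono (Nat.le_succ j) (hu a))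
        (Ideal.mul_mem_right (v a) _ (X_mem_initialVars l (Nat.lt_succ_self j)))
      convert this using 1
      simp only [Pi.sub_apply, Pi.smul_apply, smul_eq_mul]
      ring

lemma exists_nonboundary {d : ℕ}
    (hd : ∀ p : MvPolynomial (Fin n) k, (∀ m ∈ p.support, d < m.degree) → p ∈ I)
    {s : Fin n →₀ ℕ} (hs : monomial s (1 : k) ∉ I) (hsd : s.degree = d) {j : ℕ} (hj : j ≤ n) :
    ∃ z, F.DegreesIn (d + j ≤ ·) j z ∧ F.IsCycleMod (initialVars k n j) j z ∧
      ¬ ∃ u, ∀ a, (z - F.mat j *ᵥ u) a ∈ initialVars k n j := by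
  classical
  induction j with
  | zero =>
    refine ⟨fun _ => monomial s 1, fun a m hm => ?_, trivial, ?_⟩
    · rw [Finset.mem_singleton.1 (support_monomial_subset hm)]
      simp [F.deg_zero, hsd]
    · rintro ⟨u, hu⟩
      let a₀ : Fin (F.rank 0) := ⟨0, by rw [F.rank_zero]; exact one_pos⟩
      have := mem_initialVars_zero.1 (hu a₀)
      rw [Pi.sub_apply, sub_eq_zero] at this
      exact hs (this ▸ F.mulVec_mem_ideal u a₀)
  | succ j ih =>
    obtain ⟨z, hz, hcyc, hnb⟩ := ih (by omega)
    let l : Fin n := ⟨j, hj⟩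
    have hXcyc : F.IsCycleMod (initialVars k n j) j ((X l : MvPolynomial (Fin n) k) • z) := by
      cases j with
      | zero => trivial
      | succ j =>
        intro a
        rw [mulVec_smul]
        exact Ideal.mul_mem_left _ _ (hcyc a)
    obtain ⟨u, hu, hub⟩ := F.exists_boundary hd (by omega) (hz.X_smul l) hXcyc
    refine ⟨u, hu, fun a => ?_, ?_⟩
    · have := sub_mem (Ideal.mul_mem_right (z a) _ (X_mem_initialVars l (Nat.lt_succ_self j)))
        (initialVars_mono (Nat.le_succ j) (hub a))
      convert this using 1
      simp only [Pi.sub_apply, Pi.smul_apply, smul_eq_mul]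
      ring
    · rintro ⟨v, hv⟩
      let w := fun a => ((u - F.mat (j + 1) *ᵥ v) a).divMonomial (Finsupp.single l 1)
      have hr : ∀ a, (u - F.mat (j + 1) *ᵥ v - (X l : MvPolynomial (Fin n) k) • w) a ∈
          initialVars k n j := fun a => sub_X_mul_divMonomial_mem_initialVars l (hv a)
      refine hnb ⟨w, fun a => mem_initialVars_of_X_mul_mem l ?_⟩
      have := F.mulVec_mem j hr a
      rw [mulVec_sub, mulVec_sub, F.mulVec_mulVec_eq_zero, mulVec_smul, sub_zero] at this
      have := add_mem (hub a) this
      convert this using 1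
      simp only [Pi.sub_apply, Pi.smul_apply, smul_eq_mul]
      ring

lemma deg_le {d : ℕ}
    (hd : ∀ p : MvPolynomial (Fin n) k, (∀ m ∈ p.support, d < m.degree) → p ∈ I) (i : ℕ)
    (a : Fin (F.rank i)) : F.deg i a ≤ d + i := by
  classical
  by_contra! h
  have hmat : ∀ i a b, F.mat i a b ∈ initialVars k n n := fun i a b => by
    refine mem_initialVars.2 fun m hm => ?_
    have hm0 : m ≠ 0 := by
      rintro rfl
      exact mem_support_iff.1 hm (F.minimal i a b)
    obtain ⟨l, hl⟩ := DFunLike.ne_iff.1 hm0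
    exact ⟨l, l.isLt, hl⟩
  have hmul : ∀ i u a, (F.mat i *ᵥ u) a ∈ initialVars k n n := fun i u a => by
    rw [mulVec, dotProduct]
    exact Ideal.sum_mem _ fun b _ => Ideal.mul_mem_right _ _ (hmat i a b)
  obtain ⟨u, -, hu⟩ := F.exists_boundary hd le_rfl (i := i) (z := Pi.single a 1)
    (fun b m hm => by
      rcases eq_or_ne b a with rfl | hb
      · exact Nat.succ_le_of_lt (h.trans_le (Nat.le_add_left _ _))
      · simp [Pi.single_eq_of_ne hb] at hm)
    (by
      cases i with
      | zero => trivial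
      | succ i => exact hmul i _)
  have h1 : (1 : MvPolynomial (Fin n) k) ∈ initialVars k n n := by
    simpa using add_mem (hu a) (hmul i u a)
  obtain ⟨l, -, hl⟩ := mem_initialVars.1 h1 0 (by simp)
  exact hl rfl

lemma exists_le_deg {d : ℕ}
    (hd : ∀ p : MvPolynomial (Fin n) k, (∀ m ∈ p.support, d < m.degree) → p ∈ I)
    {s : Fin n →₀ ℕ} (hs : monomial s (1 : k) ∉ I) (hsd : s.degree = d) :
    ∃ a, d + n ≤ F.deg n a := by
  obtain ⟨z, hz, -, hnb⟩ := F.exists_nonboundary hd hs hsd le_rfl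
  obtain ⟨a, ha⟩ : ∃ a, z a ∉ initialVars k n n := by
    by_contra! h
    exact hnb ⟨0, by simpa using h⟩
  rw [mem_initialVars] at ha
  push Not at ha
  obtain ⟨m, hm, hm0⟩ := ha
  obtain rfl : m = 0 := Finsupp.ext fun l => hm0 l l.isLt
  exact ⟨a, by simpa using hz a 0 hm⟩

lemma one_notMem (F : MinimalGradedFreeResolution n I) :
    (1 : MvPolynomial (Fin n) k) ∉ I := by
  let a₀ : Fin (F.rank 0) := ⟨0, by rw [F.rank_zero]; exact one_pos⟩
  have hle : I ≤ RingHom.ker (constantCoeff : MvPolynomial (Fin n) k →+* k) := by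
    refine (F.resolves a₀).ge.trans (Ideal.span_le.2 ?_)
    rintro _ ⟨b, rfl⟩
    exact F.minimal 0 a₀ b
  intro h
  simpa using hle h

end MinimalGradedFreeResolution

/-- The exponents outside an Artinian monomial ideal have bounded degree. -/
lemma MvPolynomial.exists_degree_le_of_isArtinianRing {k : Type*} [Field k] {n : ℕ}
    {I : Ideal (MvPolynomial (Fin n) k)}
    (hmono : ∀ p ∈ I, ∀ m ∈ p.support, monomial m (1 : k) ∈ I)
    (hart : IsArtinianRing (MvPolynomial (Fin n) k ⧸ I)) :
    ∃ B : ℕ, ∀ s : Fin n →₀ ℕ, monomial s (1 : k) ∉ I → s.degree ≤ B := by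
  have hpow : ∀ i : Fin n, ∃ N : ℕ, monomial (Finsupp.single i N) (1 : k) ∈ I := fun i => by
    obtain ⟨N, y, hy⟩ := IsArtinian.exists_pow_succ_smul_dvd
      (Ideal.Quotient.mk I (X i)) (1 : MvPolynomial (Fin n) k ⧸ I)
    obtain ⟨f, rfl⟩ := Ideal.Quotient.mk_surjective y
    rw [smul_eq_mul, smul_eq_mul, ← map_pow, ← map_pow, ← map_one (Ideal.Quotient.mk I),
      ← map_mul, ← map_mul, Ideal.Quotient.eq, mul_one] at hy
    refine ⟨N, hmono _ hy _ ?_⟩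
    rw [mem_support_iff, coeff_sub, X_pow_eq_monomial, X_pow_eq_monomial, coeff_monomial_mul',
      if_neg (by simp)]
    simp
  choose N hN using hpow
  refine ⟨∑ i, N i, fun s hs => ?_⟩
  rw [Finsupp.degree_eq_sum]
  refine Finset.sum_le_sum fun i _ => ?_
  by_contra! h
  refine hs ?_
  have hle : Finsupp.single i (N i) ≤ s := Finsupp.single_le_iff.2 h.le
  have := Ideal.mul_mem_left I (monomial (s - Finsupp.single i (N i)) 1) (hN i)
  rwa [monomial_mul, tsub_add_cancel_of_le hle, one_mul] at this

/-- For an Artinian monomial ideal `I`, `reg(S/I)` equals the maximal degree of a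
monomial lying in `(I : m) \ I`. -/
theorem stmt9 {k : Type*} [Field k] {n : ℕ} (I : Ideal (MvPolynomial (Fin n) k))
    (hmono : ∃ 𝒮 : Set (Fin n →₀ ℕ), I = Ideal.span { m | ∃ s ∈ 𝒮, m = monomial s (1 : k) })
    (hart : IsArtinianRing (MvPolynomial (Fin n) k ⧸ I))
    (F : MinimalGradedFreeResolution n I) :
    F.reg = sSup { z : ℤ | ∃ s : Fin n →₀ ℕ,
      monomial s (1 : k) ∈ Submodule.colon I
        (Ideal.span (Set.range (X : Fin n → MvPolynomial (Fin n) k))) ∧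
      monomial s (1 : k) ∉ I ∧ z = ((s.sum fun _ e => e : ℕ) : ℤ) } := by
  have hsupp : ∀ p : MvPolynomial (Fin n) k,
      p ∈ I ↔ ∀ m ∈ p.support, monomial m (1 : k) ∈ I := by
    classical
    obtain ⟨𝒮, rfl⟩ := hmono
    have himage : {m | ∃ s ∈ 𝒮, m = monomial s (1 : k)} = (fun s => monomial s (1 : k)) '' 𝒮 := by
      ext
      simp [eq_comm]
    simp [himage, mem_ideal_span_monomial_image, coeff_monomial]
  obtain ⟨B, hB⟩ := exists_degree_le_of_isArtinianRing (fun p => (hsupp p).1) hart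
  obtain ⟨s₀, hs₀, hmax⟩ : ∃ s₀ : Fin n →₀ ℕ, monomial s₀ (1 : k) ∉ I ∧
      ∀ s : Fin n →₀ ℕ, monomial s (1 : k) ∉ I → s.degree ≤ s₀.degree := by
    let D : Set ℕ := {e | ∃ s : Fin n →₀ ℕ, monomial s (1 : k) ∉ I ∧ s.degree = e}
    have hbdd : BddAbove D := ⟨B, by rintro _ ⟨s, hs, rfl⟩; exact hB s hs⟩
    obtain ⟨s₀, hs₀, he⟩ := Nat.sSup_mem (s := D) ⟨0, 0, F.one_notMem, by simp⟩ hbdd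
    exact ⟨s₀, hs₀, fun s hs => he ▸ le_csSup hbdd ⟨s, hs, rfl⟩⟩
  have hd : ∀ p : MvPolynomial (Fin n) k, (∀ m ∈ p.support, s₀.degree < m.degree) → p ∈ I :=
    fun p hp => (hsupp p).2 fun m hm => by
      by_contra h
      exact (hp m hm).not_ge (hmax m h)
  have hreg : IsGreatest { z : ℤ | ∃ (i : ℕ) (a : Fin (F.rank i)), z = (F.deg i a : ℤ) - (i : ℤ) }
      (s₀.degree : ℤ) := by
    constructor
    · obtain ⟨a, ha⟩ := F.exists_le_deg hd hs₀ rfl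
      have := F.deg_le hd n a
      exact ⟨n, a, by omega⟩
    · rintro _ ⟨i, a, rfl⟩
      have := F.deg_le hd i a
      omega
  refine hreg.csSup_eq.trans (Eq.symm (IsGreatest.csSup_eq ?_))
  constructor
  · refine ⟨s₀, ?_, hs₀, rfl⟩
    rw [Ideal.colon_span, Submodule.mem_colon]
    rintro _ ⟨l, rfl⟩
    refine hd _ fun m hm => ?_
    rw [smul_eq_mul, X, monomial_mul] at hm
    rw [Finset.mem_singleton.1 (support_monomial_subset hm)]
    simp
  · rintro _ ⟨s, -, hs, rfl⟩
    exact Int.ofNat_le.2 (hmax s hs)
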